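/- Let n ≥ 2 and let p : ℝⁿ → ℝ be measurable with 2 ≤ p_- ≤ p_+ < ∞. If p is locally log-Hölder continuous, i.e. there exists c₀ > 0 such that |p(x) − p(y)| ≤ c₀/(−log|x − y|) for all x, y ∈ ℝⁿ with |x − y| < 1/2, then C_0^∞(ℝⁿ) is dense in W^{1,p(·)}(ℝⁿ): for every f ∈ W^{1,p(·)}(ℝⁿ) and every ε > 0 there exists a smooth compactly supported g : ℝⁿ → ℝ with ‖f − g‖_{1,p(·)} < ε. -/

import Mathlib

open MeasureTheory ENNReal Filter Topology

noncomputable section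

abbrev Euc (n : ℕ) : Type := EuclideanSpace ℝ (Fin n)

/-- The modular `ρ_{p(·)}(f) = ∫ |f(x)|^{p(x)} dx` of variable exponent Lebesgue spaces. -/
def varModular (n : ℕ) (p f : Euc n → ℝ) : ℝ≥0∞ :=
  ∫⁻ x, ENNReal.ofReal (|f x| ^ p x)

/-- The Luxemburg norm `‖f‖_{p(·)} = inf {c > 0 : ρ_{p(·)}(f/c) ≤ 1}`. -/
def varNorm (n : ℕ) (p f : Euc n → ℝ) : ℝ :=
  sInf {c : ℝ | 0 < c ∧ varModular n p (fun x => f x / c) ≤ 1}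

/-- Membership in the variable exponent Lebesgue space `L^{p(·)}(ℝⁿ)`. -/
def MemVarLp (n : ℕ) (p f : Euc n → ℝ) : Prop :=
  AEMeasurable f volume ∧ varModular n p f < ⊤

/-- `g` is the `i`-th distributional partial derivative of `f`. -/
def IsWeakDeriv (n : ℕ) (i : Fin n) (f g : Euc n → ℝ) : Prop :=
  LocallyIntegrable f volume ∧ LocallyIntegrable g volume ∧
  ∀ φ : Euc n → ℝ, ContDiff ℝ (⊤ : ℕ∞) φ → HasCompactSupport φ →
    ∫ x, f x * fderiv ℝ φ x (EuclideanSpace.single i 1) = - ∫ x, g x * φ x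

/-- `C_0^∞(ℝⁿ)` is dense in `W^{1,p(·)}(ℝⁿ)`: every Sobolev function `f`, together with its
weak partial derivatives `Df i`, can be approximated in the norm
`‖·‖_{1,p(·)} = ‖·‖_{p(·)} + ∑ ‖D_i ·‖_{p(·)}` by smooth compactly supported functions. -/
def DenseSmooth (n : ℕ) (p : Euc n → ℝ) : Prop :=
  ∀ (f : Euc n → ℝ) (Df : Fin n → Euc n → ℝ),
    MemVarLp n p f →
    (∀ i, IsWeakDeriv n i f (Df i) ∧ MemVarLp n p (Df i)) →
    ∀ ε : ℝ, 0 < ε →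
      ∃ g : Euc n → ℝ, ContDiff ℝ (⊤ : ℕ∞) g ∧ HasCompactSupport g ∧
        varNorm n p (fun x => f x - g x) +
          ∑ i : Fin n, varNorm n p
            (fun x => Df i x - fderiv ℝ g x (EuclideanSpace.single i 1)) < ε

section Modular

variable {n : ℕ} {p : Euc n → ℝ}

theorem varModular_eq_lintegral_enorm (hp : ∀ x, 2 ≤ p x) (f : Euc n → ℝ) :
    varModular n p f = ∫⁻ x, ‖f x‖ₑ ^ p x := by
  refine lintegral_congr fun x => ?_
  rw [Real.enorm_eq_ofReal_abs, ENNReal.ofReal_rpow_of_nonneg (abs_nonneg _)]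
  linarith [hp x]

theorem aemeasurable_enorm_rpow (hpm : Measurable p) {f : Euc n → ℝ}
    (hf : AEMeasurable f) : AEMeasurable (fun x => ‖f x‖ₑ ^ p x) :=
  hf.enorm.pow hpm.aemeasurable

theorem varNorm_le_of_varModular_le_one {f : Euc n → ℝ} {c : ℝ} (hc : 0 < c)
    (h : varModular n p (fun x => f x / c) ≤ 1) : varNorm n p f ≤ c :=
  csInf_le ⟨0, fun _ ha => ha.1.le⟩ ⟨hc, h⟩

theorem enorm_mul_rpow_le (hp : ∀ x, 2 ≤ p x) {C : ℝ} (hpC : ∀ x, p x ≤ C) {B : ℝ}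
    (hB : 1 ≤ B) {a t : ℝ} (ha : |a| ≤ B) (x : Euc n) :
    ‖a * t‖ₑ ^ p x ≤ ENNReal.ofReal (B ^ C) * ‖t‖ₑ ^ p x := by
  have h0 : 0 ≤ p x := by linarith [hp x]
  rw [enorm_mul, ENNReal.mul_rpow_of_nonneg _ _ h0, ← ENNReal.ofReal_rpow_of_pos (by linarith)]
  gcongr
  calc ‖a‖ₑ ^ p x ≤ ENNReal.ofReal B ^ p x := by
        rw [Real.enorm_eq_ofReal_abs]; gcongr
    _ ≤ ENNReal.ofReal B ^ C :=
        ENNReal.rpow_le_rpow_of_exponent_le (by simpa using hB) (hpC x)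

theorem varModular_mul_le (hp : ∀ x, 2 ≤ p x) {C : ℝ} (hpC : ∀ x, p x ≤ C) {B : ℝ}
    (hB : 1 ≤ B) {a f : Euc n → ℝ} (ha : ∀ x, |a x| ≤ B) :
    varModular n p (fun x => a x * f x) ≤ ENNReal.ofReal (B ^ C) * varModular n p f := by
  simp only [varModular_eq_lintegral_enorm hp]
  rw [← lintegral_const_mul' _ _ ENNReal.ofReal_ne_top]
  exact lintegral_mono fun x => enorm_mul_rpow_le hp hpC hB (ha x) x

theorem varNorm_le_of_varModular_le (hp : ∀ x, 2 ≤ p x) {C : ℝ} (hpC : ∀ x, p x ≤ C)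
    {f : Euc n → ℝ} {c : ℝ} (hc : 0 < c) (hc1 : c ≤ 1)
    (h : varModular n p f ≤ ENNReal.ofReal (c ^ C)) : varNorm n p f ≤ c := by
  refine varNorm_le_of_varModular_le_one hc ?_
  have h1 : varModular n p (fun x => f x / c) = varModular n p (fun x => c⁻¹ * f x) := by
    congr 1; ext x; rw [div_eq_inv_mul]
  rw [h1]
  refine (varModular_mul_le hp hpC (B := c⁻¹) ((one_le_inv₀ hc).2 hc1)
    (fun x => (abs_of_pos (inv_pos.2 hc)).le)).trans ?_
  refine (mul_le_mul_right h _).trans ?_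
  rw [← ENNReal.ofReal_mul (by positivity), ← Real.mul_rpow (by positivity) hc.le,
    inv_mul_cancel₀ hc.ne']
  simp

theorem varModular_add_le (hpm : Measurable p) (hp : ∀ x, 2 ≤ p x) {C : ℝ}
    (hpC : ∀ x, p x ≤ C) {f g : Euc n → ℝ} (hf : AEMeasurable f) :
    varModular n p (fun x => f x + g x) ≤
      ENNReal.ofReal (2 ^ C) * (varModular n p f + varModular n p g) := by
  simp only [varModular_eq_lintegral_enorm hp]
  rw [← lintegral_add_left' (aemeasurable_enorm_rpow hpm hf),
    ← lintegral_const_mul' _ _ ENNReal.ofReal_ne_top]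
  refine lintegral_mono fun x => ?_
  have h0 : 0 ≤ p x := by linarith [hp x]
  calc ‖f x + g x‖ₑ ^ p x ≤ (‖f x‖ₑ + ‖g x‖ₑ) ^ p x := by
        gcongr; exact enorm_add_le _ _
    _ ≤ 2 ^ (p x - 1) * (‖f x‖ₑ ^ p x + ‖g x‖ₑ ^ p x) :=
        ENNReal.rpow_add_le_mul_rpow_add_rpow _ _ (by linarith [hp x])
    _ ≤ _ := by
        gcongr
        rw [← ENNReal.ofReal_rpow_of_pos two_pos, ENNReal.ofReal_ofNat]
        exact ENNReal.rpow_le_rpow_of_exponent_le (by norm_num) (by linarith [hpC x])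

theorem tendsto_varModular_add (hpm : Measurable p) (hp : ∀ x, 2 ≤ p x) {C : ℝ}
    (hpC : ∀ x, p x ≤ C) {f g : ℕ → Euc n → ℝ} (hf : ∀ k, AEMeasurable (f k))
    (hf0 : Tendsto (fun k => varModular n p (f k)) atTop (𝓝 0))
    (hg0 : Tendsto (fun k => varModular n p (g k)) atTop (𝓝 0)) :
    Tendsto (fun k => varModular n p (fun x => f k x + g k x)) atTop (𝓝 0) := by
  refine tendsto_of_tendsto_of_tendsto_of_le_of_le tendsto_const_nhds ?_ (fun _ => zero_le)
    (fun k => varModular_add_le hpm hp hpC (hf k))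
  have := ENNReal.Tendsto.const_mul (a := ENNReal.ofReal (2 ^ C)) (hf0.add hg0)
    (Or.inr ENNReal.ofReal_ne_top)
  simpa using this

/-- Dominated convergence for the modular. -/
theorem tendsto_varModular_of_dominated (hpm : Measurable p) (hp : ∀ x, 2 ≤ p x)
    {h : ℕ → Euc n → ℝ} (hh : ∀ k, AEMeasurable (h k)) (b : Euc n → ℝ≥0∞)
    (hb : ∫⁻ x, b x ≠ ⊤) (hle : ∀ k x, ‖h k x‖ₑ ^ p x ≤ b x)
    (hlim : ∀ᵐ x, Tendsto (fun k => h k x) atTop (𝓝 0)) :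
    Tendsto (fun k => varModular n p (h k)) atTop (𝓝 0) := by
  simp only [varModular_eq_lintegral_enorm hp]
  have h0 : (0 : ℝ≥0∞) = ∫⁻ _ : Euc n, 0 := by simp
  rw [h0]
  refine tendsto_lintegral_of_dominated_convergence' b
    (fun k => aemeasurable_enorm_rpow hpm (hh k))
    (fun k => Eventually.of_forall (hle k)) hb ?_
  filter_upwards [hlim] with x hx
  have h1 : Tendsto (fun k => ‖h k x‖ₑ) atTop (𝓝 0) := by
    simpa using hx.enorm
  have h2 : 0 < p x := by linarith [hp x]
  simpa [ENNReal.zero_rpow_of_pos h2] using h1.ennrpow_const (p x)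

theorem tendsto_varModular_mul (hpm : Measurable p) (hp : ∀ x, 2 ≤ p x) {C : ℝ}
    (hpC : ∀ x, p x ≤ C) {B : ℝ} (hB : 1 ≤ B) {a : ℕ → Euc n → ℝ} {f : Euc n → ℝ}
    (ha : ∀ k, AEMeasurable (a k)) (hf : MemVarLp n p f) (haB : ∀ k x, |a k x| ≤ B)
    (hlim : ∀ x, Tendsto (fun k => a k x) atTop (𝓝 0)) :
    Tendsto (fun k => varModular n p (fun x => a k x * f x)) atTop (𝓝 0) := by
  refine tendsto_varModular_of_dominated hpm hp (fun k => (ha k).mul hf.1)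
    (fun x => ENNReal.ofReal (B ^ C) * ‖f x‖ₑ ^ p x) ?_
    (fun k x => enorm_mul_rpow_le hp hpC hB (haB k x) x) ?_
  · rw [lintegral_const_mul' _ _ ENNReal.ofReal_ne_top, ← varModular_eq_lintegral_enorm hp]
    exact ENNReal.mul_ne_top ENNReal.ofReal_ne_top hf.2.ne
  · exact Eventually.of_forall fun x => by simpa using (hlim x).mul_const (f x)

theorem MemVarLp.bdd_mul (hp : ∀ x, 2 ≤ p x) {C : ℝ} (hpC : ∀ x, p x ≤ C) {B : ℝ}
    {a f : Euc n → ℝ} (hf : MemVarLp n p f) (ha : AEMeasurable a)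
    (haB : ∀ x, |a x| ≤ B) : MemVarLp n p (fun x => a x * f x) :=
  ⟨ha.mul hf.1, (varModular_mul_le hp hpC (le_max_left 1 B)
    (fun x => (haB x).trans (le_max_right _ _))).trans_lt
    (ENNReal.mul_lt_top ENNReal.ofReal_lt_top hf.2)⟩

theorem MemVarLp.add (hpm : Measurable p) (hp : ∀ x, 2 ≤ p x) {C : ℝ} (hpC : ∀ x, p x ≤ C)
    {f g : Euc n → ℝ} (hf : MemVarLp n p f) (hg : MemVarLp n p g) :
    MemVarLp n p (fun x => f x + g x) :=
  ⟨hf.1.add hg.1, (varModular_add_le hpm hp hpC hf.1).trans_lt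
    (ENNReal.mul_lt_top ENNReal.ofReal_lt_top (ENNReal.add_lt_top.2 ⟨hf.2, hg.2⟩))⟩

end Modular

section LogHolder

variable {n : ℕ} {p : Euc n → ℝ} {c₀ : ℝ}

theorem continuous_of_log_holder
    (hlog : ∀ x y : Euc n, dist x y < 1/2 → |p x - p y| ≤ c₀ / (- Real.log (dist x y))) :
    Continuous p := by
  refine continuous_iff_continuousAt.2 fun y => continuousAt_iff_punctured_nhds.2 ?_
  rw [tendsto_iff_dist_tendsto_zero]
  have h1 : Tendsto (fun x => dist x y) (𝓝[≠] y) (𝓝[>] 0) := by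
    refine tendsto_nhdsWithin_iff.2 ⟨?_, ?_⟩
    · exact (tendsto_iff_dist_tendsto_zero.1 tendsto_id).mono_left nhdsWithin_le_nhds
    · filter_upwards [self_mem_nhdsWithin] with x hx using dist_pos.2 hx
  have h2 : Tendsto (fun x => c₀ / (- Real.log (dist x y))) (𝓝[≠] y) (𝓝 0) :=
    (tendsto_neg_atBot_atTop.comp (Real.tendsto_log_nhdsGT_zero.comp h1)).const_div_atTop c₀
  refine squeeze_zero' (Eventually.of_forall fun _ => dist_nonneg) ?_ h2
  filter_upwards [nhdsWithin_le_nhds (Metric.ball_mem_nhds y (by norm_num : (0:ℝ) < 1/2))]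
    with x hx
  exact hlog x y hx

theorem forall_le_of_ae_le {α : Type*} [TopologicalSpace α] [MeasurableSpace α] {μ : Measure α}
    [μ.IsOpenPosMeasure] {f g : α → ℝ} (hf : Continuous f)
    (hg : Continuous g) (h : ∀ᵐ x ∂μ, f x ≤ g x) (x : α) : f x ≤ g x := by
  have h1 : μ {x | g x < f x} = 0 := by simpa [ae_iff] using h
  have h2 := (isOpen_lt hg hf).measure_eq_zero_iff μ |>.1 h1
  by_contra hx
  exact Set.notMem_empty x (h2 ▸ (not_le.1 hx : x ∈ {x | g x < f x}))

end LogHolder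

section Mollify

variable {n : ℕ}

/-- Convolution of `F` with the normalised bump function `φ`. -/
def mollify (φ : ContDiffBump (0 : Euc n)) (F : Euc n → ℝ) : Euc n → ℝ :=
  convolution (φ.normed volume) F (ContinuousLinearMap.lsmul ℝ ℝ) volume

theorem mollify_apply (φ : ContDiffBump (0 : Euc n)) (F : Euc n → ℝ) (x : Euc n) :
    mollify φ F x = ∫ y, φ.normed volume (x - y) * F y := by
  rw [mollify, convolution_lsmul_swap]; rfl

theorem contDiff_mollify (φ : ContDiffBump (0 : Euc n)) {F : Euc n → ℝ}
    (hF : LocallyIntegrable F) : ContDiff ℝ (⊤ : ℕ∞) (mollify φ F) :=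
  φ.hasCompactSupport_normed.contDiff_convolution_left _ φ.contDiff_normed hF

theorem mollify_add (φ : ContDiffBump (0 : Euc n)) {F G : Euc n → ℝ}
    (hF : LocallyIntegrable F) (hG : LocallyIntegrable G) (x : Euc n) :
    mollify φ (fun x => F x + G x) x = mollify φ F x + mollify φ G x := by
  have h (H : Euc n → ℝ) (hH : LocallyIntegrable H) : ConvolutionExistsAt (φ.normed volume) H x
      (ContinuousLinearMap.lsmul ℝ ℝ) volume :=
    φ.hasCompactSupport_normed.convolutionExists_left _ φ.continuous_normed hH x
  exact (h F hF).distrib_add (h G hG)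

theorem normed_sub_eq_zero (φ : ContDiffBump (0 : Euc n)) {x y : Euc n}
    (h : φ.rOut ≤ dist x y) : φ.normed volume (x - y) = 0 := by
  have : x - y ∉ Function.support (φ.normed volume) := by
    rw [φ.support_normed_eq]; simpa [dist_eq_norm] using h
  simpa using this

theorem mollify_eq_zero (φ : ContDiffBump (0 : Euc n)) {F : Euc n → ℝ} {R : ℝ}
    (hF : ∀ x, R < ‖x‖ → F x = 0) {x : Euc n} (hx : R + φ.rOut < ‖x‖) : mollify φ F x = 0 := by
  rw [mollify_apply]
  refine integral_eq_zero_of_ae (Eventually.of_forall fun y => ?_)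
  rcases lt_or_ge R ‖y‖ with hy | hy
  · simp [hF y hy]
  · have : φ.rOut ≤ dist x y := by
      have := norm_sub_norm_le x y
      rw [dist_eq_norm]; linarith
    simp [normed_sub_eq_zero φ this]

theorem abs_mollify_le (φ : ContDiffBump (0 : Euc n)) {F : Euc n → ℝ}
    (hFm : AEStronglyMeasurable F) {B : ℝ} (hB : 0 ≤ B) (hF : ∀ x, |F x| ≤ B) (x : Euc n) :
    |mollify φ F x| ≤ B := by
  have := dist_convolution_le (z₀ := (0 : ℝ)) (x₀ := x) hB φ.support_normed_eq.subset
    φ.nonneg_normed (φ.integral_normed (μ := volume)) hFm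
    (fun y _ => by simpa using hF y)
  simpa [mollify] using this

theorem fderiv_mollify (φ : ContDiffBump (0 : Euc n)) {F G : Euc n → ℝ} {i : Fin n}
    (h : IsWeakDeriv n i F G) (x : Euc n) :
    fderiv ℝ (mollify φ F) x (EuclideanSpace.single i 1) = mollify φ G x := by
  set ρ := φ.normed volume with hρ
  have hρs : ContDiff ℝ (⊤ : ℕ∞) ρ := φ.contDiff_normed
  have hρc : HasCompactSupport ρ := φ.hasCompactSupport_normed
  have hρ1 : ContDiff ℝ 1 ρ := φ.contDiff_normed (n := 1)
  have hd : fderiv ℝ (mollify φ F) x = _ :=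
    (hρc.hasFDerivAt_convolution_left (ContinuousLinearMap.lsmul ℝ ℝ) hρ1 h.1 x).fderiv
  have hex : ConvolutionExistsAt (fderiv ℝ ρ) F x
      ((ContinuousLinearMap.lsmul ℝ ℝ).precompL (Euc n)) volume :=
    (hρc.fderiv ℝ).convolutionExists_left _ (hρ1.continuous_fderiv one_ne_zero) h.1 x
  rw [hd, convolution_eq_swap, ContinuousLinearMap.integral_apply hex.integrable_swap,
    mollify_apply]
  have hψ : ContDiff ℝ (⊤ : ℕ∞) (fun y => ρ (x - y)) := hρs.comp (contDiff_const.sub contDiff_id)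
  have hψc : HasCompactSupport (fun y => ρ (x - y)) :=
    hρc.comp_homeomorph (Homeomorph.subLeft x)
  have key := h.2.2 _ hψ hψc
  have hfd (y : Euc n) : fderiv ℝ (fun y => ρ (x - y)) y (EuclideanSpace.single i 1) =
      - fderiv ℝ ρ (x - y) (EuclideanSpace.single i 1) := by
    have h1 : HasFDerivAt (fun y => ρ (x - y))
        ((fderiv ℝ ρ (x - y)).comp (-ContinuousLinearMap.id ℝ (Euc n))) y :=
      HasFDerivAt.comp y (hρ1.differentiable one_ne_zero (x - y)).hasFDerivAt
        ((hasFDerivAt_id y).const_sub x)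
    rw [h1.fderiv]; simp
  simp only [hfd, mul_neg, integral_neg, neg_inj] at key
  simpa [ContinuousLinearMap.precompL_apply, mul_comm] using key

end Mollify

section LocallyIntegrable

variable {n : ℕ}

theorem locallyIntegrable_bdd_mul {a f : Euc n → ℝ} (hf : LocallyIntegrable f)
    (ha : AEStronglyMeasurable a) {B : ℝ} (haB : ∀ x, |a x| ≤ B) :
    LocallyIntegrable (fun x => a x * f x) := by
  refine (hf.smul B).mono (ha.mul hf.aestronglyMeasurable) (Eventually.of_forall fun x => ?_)
  simp only [norm_mul, Real.norm_eq_abs, Pi.smul_apply, smul_eq_mul]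
  exact mul_le_mul_of_nonneg_right ((haB x).trans (le_abs_self B)) (abs_nonneg _)

theorem IsWeakDeriv.smooth_mul {i : Fin n} {f g χ : Euc n → ℝ} (h : IsWeakDeriv n i f g)
    (hχ : ContDiff ℝ (⊤ : ℕ∞) χ) (hχc : HasCompactSupport χ) :
    IsWeakDeriv n i (fun x => χ x * f x)
      (fun x => χ x * g x + fderiv ℝ χ x (EuclideanSpace.single i 1) * f x) := by
  set e : Euc n := EuclideanSpace.single i 1
  have hχ' : Continuous (fun x => fderiv ℝ χ x e) :=
    (hχ.continuous_fderiv (by simp)).clm_apply continuous_const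
  have h1 : LocallyIntegrable (fun x => χ x * f x) := h.1.continuous_mul hχ.continuous
  have h2 : LocallyIntegrable (fun x => χ x * g x) := h.2.1.continuous_mul hχ.continuous
  have h3 : LocallyIntegrable (fun x => fderiv ℝ χ x e * f x) := h.1.continuous_mul hχ'
  refine ⟨h1, h2.add h3, fun φ hφ hφc => ?_⟩
  have hφ' : Continuous (fun x => fderiv ℝ φ x e) :=
    (hφ.continuous_fderiv (by simp)).clm_apply continuous_const
  have hφ'c : HasCompactSupport (fun x => fderiv ℝ φ x e) := hφc.fderiv_apply ℝ e
  have key := h.2.2 (fun x => χ x * φ x) (hχ.mul hφ) hχc.mul_right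
  have hfd (x : Euc n) : fderiv ℝ (fun x => χ x * φ x) x e =
      χ x * fderiv ℝ φ x e + φ x * fderiv ℝ χ x e := by
    rw [fderiv_fun_mul (hχ.differentiable (by simp) x) (hφ.differentiable (by simp) x)]
    rfl
  have i1 : Integrable (fun x => χ x * f x * fderiv ℝ φ x e) := by
    have := h1.integrable_smul_left_of_hasCompactSupport hφ' hφ'c
    simpa [mul_comm] using this
  have i2 : Integrable (fun x => χ x * g x * φ x) := by
    have := h2.integrable_smul_left_of_hasCompactSupport hφ.continuous hφc
    simpa [mul_comm] using this
  have i3 : Integrable (fun x => fderiv ℝ χ x e * f x * φ x) := by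
    have := h3.integrable_smul_left_of_hasCompactSupport hφ.continuous hφc
    simpa [mul_comm] using this
  have e1 : ∫ x, f x * fderiv ℝ (fun x => χ x * φ x) x e =
      (∫ x, χ x * f x * fderiv ℝ φ x e) + ∫ x, fderiv ℝ χ x e * f x * φ x := by
    rw [← integral_add i1 i3]
    congr 1; ext x; rw [hfd]; ring
  have e2 : ∫ x, (χ x * g x + fderiv ℝ χ x e * f x) * φ x =
      (∫ x, χ x * g x * φ x) + ∫ x, fderiv ℝ χ x e * f x * φ x := by
    rw [← integral_add i2 i3]
    congr 1; ext x; ring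
  have e3 : ∫ x, g x * (χ x * φ x) = ∫ x, χ x * g x * φ x := by
    congr 1; ext x; ring
  rw [e2]
  linarith

end LocallyIntegrable

section Young

variable {n : ℕ} {p : Euc n → ℝ} {c₀ : ℝ}

theorem lintegral_normed_sub_left (φ : ContDiffBump (0 : Euc n)) (x : Euc n) :
    ∫⁻ y, ENNReal.ofReal (φ.normed volume (x - y)) = 1 := by
  rw [lintegral_sub_left_eq_self (fun y => ENNReal.ofReal (φ.normed volume y)) x,
    ← ofReal_integral_eq_lintegral_ofReal φ.integrable_normed
      (Eventually.of_forall φ.nonneg_normed), φ.integral_normed, ENNReal.ofReal_one]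

theorem lintegral_normed_sub_right (φ : ContDiffBump (0 : Euc n)) (y : Euc n) :
    ∫⁻ x, ENNReal.ofReal (φ.normed volume (x - y)) = 1 := by
  rw [lintegral_sub_right_eq_self (fun y => ENNReal.ofReal (φ.normed volume y)) y,
    ← ofReal_integral_eq_lintegral_ofReal φ.integrable_normed
      (Eventually.of_forall φ.nonneg_normed), φ.integral_normed, ENNReal.ofReal_one]

/-- Jensen's inequality for mollification with a bump function. -/
theorem enorm_mollify_rpow_le (φ : ContDiffBump (0 : Euc n)) {F : Euc n → ℝ}
    (hF : AEMeasurable F) {q : ℝ} (hq : 1 ≤ q) (x : Euc n) :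
    ‖mollify φ F x‖ₑ ^ q ≤
      ∫⁻ y, ENNReal.ofReal (φ.normed volume (x - y)) * ‖F y‖ₑ ^ q := by
  set w : Euc n → ℝ≥0∞ := fun y => ENNReal.ofReal (φ.normed volume (x - y)) with hw
  have hwm : Measurable w :=
    (φ.continuous_normed.comp (continuous_const.sub continuous_id)).measurable.ennreal_ofReal
  have hprob : IsProbabilityMeasure (volume.withDensity w) :=
    ⟨by rw [withDensity_apply _ MeasurableSet.univ, Measure.restrict_univ,
      lintegral_normed_sub_left]⟩
  have h1 : ‖mollify φ F x‖ₑ ≤ ∫⁻ y, ‖F y‖ₑ ∂(volume.withDensity w) := by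
    rw [lintegral_withDensity_eq_lintegral_mul₀ hwm.aemeasurable hF.enorm, mollify_apply]
    refine (enorm_integral_le_lintegral_enorm _).trans (lintegral_mono fun y => ?_)
    rw [enorm_mul, Real.enorm_of_nonneg (φ.nonneg_normed _)]
    rfl
  have h2 := eLpNorm'_le_eLpNorm'_of_exponent_le one_pos hq (volume.withDensity w)
    (hF.mono' (withDensity_absolutelyContinuous volume w)).aestronglyMeasurable
  have hq0 : 0 < q := by linarith
  simp only [eLpNorm', ENNReal.rpow_one, div_one] at h2
  have h3 := ENNReal.rpow_le_rpow (h1.trans h2) hq0.le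
  rwa [← ENNReal.rpow_mul, one_div, inv_mul_cancel₀ hq0.ne', ENNReal.rpow_one,
    lintegral_withDensity_eq_lintegral_mul₀ hwm.aemeasurable (hF.enorm.pow_const q)] at h3

theorem exists_normed_le (n : ℕ) : ∃ K : ℝ, 1 ≤ K ∧ ∀ φ : ContDiffBump (0 : Euc n),
    φ.rOut ≤ 2 * φ.rIn → ∀ x, φ.normed volume x ≤ K / φ.rOut ^ n := by
  refine ⟨max 1 (2 ^ n / volume.real (Metric.ball (0 : Euc n) 1)), le_max_left _ _,
    fun φ h x => ?_⟩
  have h1 := φ.normed_le_div_measure_closedBall_rOut volume 2 h x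
  rw [Measure.addHaar_real_closedBall _ _ φ.rOut_pos.le, finrank_euclideanSpace_fin] at h1
  refine h1.trans ?_
  rw [mul_comm, ← div_div]
  exact div_le_div_of_nonneg_right (le_max_right _ _) (pow_nonneg φ.rOut_pos.le n)

/-- The kernel bound raised to the oscillation of a log-Hölder exponent stays bounded. -/
theorem div_pow_rpow_le {K r : ℝ} (hK : 1 ≤ K) (hr : 0 < r) (hr1 : r < 1)
    (hc : 0 < c₀) (hcr : c₀ ≤ -Real.log r) :
    (K / r ^ n) ^ (c₀ / (-Real.log r)) ≤ K * Real.exp (c₀ * n) := by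
  have hl : 0 < -Real.log r := by linarith
  have hδ : c₀ / (-Real.log r) ≤ 1 := (div_le_one hl).2 hcr
  have hδ0 : 0 < c₀ / (-Real.log r) := div_pos hc hl
  rw [div_eq_mul_inv, Real.mul_rpow (by linarith) (by positivity)]
  refine mul_le_mul ?_ (le_of_eq ?_) (by positivity) (by linarith)
  · simpa using Real.rpow_le_rpow_of_exponent_le hK hδ
  · rw [Real.rpow_def_of_pos (by positivity), Real.log_inv, Real.log_pow]
    have h0 : Real.log r ≠ 0 := by intro h; simp [h] at hl
    congr 1
    field_simp

/-- Mollification at small scales is bounded in the modular of a log-Hölder exponent, on functions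
whose nonzero values are at least one in absolute value. -/
theorem exists_varModular_mollify_le (hpm : Measurable p) (hp : ∀ x, 2 ≤ p x) (hc : 0 < c₀)
    (hlog : ∀ x y : Euc n, dist x y < 1/2 → |p x - p y| ≤ c₀ / (- Real.log (dist x y))) :
    ∃ K : ℝ, ∀ φ : ContDiffBump (0 : Euc n), φ.rOut ≤ 2 * φ.rIn → φ.rOut < 1/2 →
      c₀ ≤ -Real.log φ.rOut → ∀ F : Euc n → ℝ, AEMeasurable F →
      (∀ x, F x = 0 ∨ 1 ≤ |F x|) → varModular n p F ≤ 1 →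
      varModular n p (mollify φ F) ≤ ENNReal.ofReal K * varModular n p F := by
  obtain ⟨K, hK, hKφ⟩ := exists_normed_le n
  refine ⟨K * Real.exp (c₀ * n), fun φ hφ hr hcr F hF hF1 hM => ?_⟩
  have hr0 := φ.rOut_pos
  set r := φ.rOut with hrdef
  set δ := c₀ / (-Real.log r) with hδdef
  have hl : 0 < -Real.log r := by linarith
  have hδ : δ ≤ 1 := (div_le_one hl).2 hcr
  have hδ0 : 0 < δ := div_pos hc hl
  set G : Euc n → ℝ≥0∞ := fun x =>
    ∫⁻ y, ENNReal.ofReal (φ.normed volume (x - y)) * ‖F y‖ₑ ^ p y with hG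
  have hpF : AEMeasurable (fun y => ‖F y‖ₑ ^ p y) := aemeasurable_enorm_rpow hpm hF
  have hGint : ∫⁻ x, G x = varModular n p F := by
    rw [varModular_eq_lintegral_enorm hp, hG, lintegral_lintegral_swap]
    · refine lintegral_congr fun y => ?_
      have hm : Measurable fun x => ENNReal.ofReal (φ.normed volume (x - y)) :=
        (φ.continuous_normed.comp
          (continuous_id.sub continuous_const)).measurable.ennreal_ofReal
      rw [lintegral_mul_const _ hm, lintegral_normed_sub_right, one_mul]
    · exact (φ.continuous_normed.comp
        (continuous_fst.sub continuous_snd)).measurable.ennreal_ofReal.aemeasurable.mul hpF.comp_snd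
  have hGle (x : Euc n) : G x ≤ ENNReal.ofReal (K / r ^ n) := by
    calc G x ≤ ∫⁻ y, ENNReal.ofReal (K / r ^ n) * ‖F y‖ₑ ^ p y :=
          lintegral_mono fun y => mul_le_mul_left (ENNReal.ofReal_le_ofReal (hKφ φ hφ _)) _
      _ = ENNReal.ofReal (K / r ^ n) * varModular n p F := by
          rw [lintegral_const_mul' _ _ ENNReal.ofReal_ne_top, varModular_eq_lintegral_enorm hp]
      _ ≤ _ := mul_le_of_le_one_right' hM
  have hL1 : 1 ≤ K / r ^ n :=
    (one_le_div (by positivity)).2 ((pow_le_one₀ hr0.le (by linarith)).trans hK)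
  have hpt (x : Euc n) : ‖mollify φ F x‖ₑ ^ p x ≤
      ENNReal.ofReal (K * Real.exp (c₀ * n)) * G x := by
    set q := p x - δ with hq
    have hq1 : 1 ≤ q := by linarith [hp x]
    have hq0 : 0 < q := by linarith
    have h1 : ‖mollify φ F x‖ₑ ^ q ≤ G x := by
      refine (enorm_mollify_rpow_le φ hF hq1 x).trans (lintegral_mono fun y => ?_)
      rcases le_or_gt r (dist x y) with hxy | hxy
      · simp [normed_sub_eq_zero φ hxy]
      refine mul_le_mul_right ?_ _
      rcases hF1 y with h0 | h0
      · simp [h0, ENNReal.zero_rpow_of_pos hq0]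
      · refine ENNReal.rpow_le_rpow_of_exponent_le ?_ ?_
        · rw [Real.enorm_eq_ofReal_abs]; simpa using h0
        · have hxy' := (abs_le.1 (hlog x y (hxy.trans hr))).2
          rcases eq_or_ne x y with rfl | hne
          · linarith
          have hd : 0 < dist x y := dist_pos.2 hne
          have h2 : c₀ / (-Real.log (dist x y)) ≤ δ := by
            refine div_le_div_of_nonneg_left hc.le hl ?_
            linarith [Real.log_le_log hd hxy.le]
          linarith
    calc ‖mollify φ F x‖ₑ ^ p x = (‖mollify φ F x‖ₑ ^ q) ^ (1 + δ / q) := by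
          rw [← ENNReal.rpow_mul]
          congr 1
          field_simp
          linarith
      _ ≤ G x ^ (1 + δ / q) := ENNReal.rpow_le_rpow h1 (by positivity)
      _ = G x * G x ^ (δ / q) := by
          rw [ENNReal.rpow_add_of_nonneg _ _ zero_le_one (by positivity), ENNReal.rpow_one]
      _ ≤ G x * ENNReal.ofReal (K * Real.exp (c₀ * n)) := by
          refine mul_le_mul_right ?_ _
          calc G x ^ (δ / q) ≤ ENNReal.ofReal (K / r ^ n) ^ (δ / q) :=
                ENNReal.rpow_le_rpow (hGle x) (by positivity)
            _ ≤ ENNReal.ofReal (K / r ^ n) ^ δ :=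
                ENNReal.rpow_le_rpow_of_exponent_le (by simpa using hL1)
                  (div_le_self hδ0.le hq1)
            _ = ENNReal.ofReal ((K / r ^ n) ^ δ) :=
                ENNReal.ofReal_rpow_of_pos (by positivity)
            _ ≤ _ := ENNReal.ofReal_le_ofReal
                (div_pow_rpow_le hK hr0 (by linarith) hc hcr)
      _ = _ := mul_comm _ _
  calc varModular n p (mollify φ F)
      ≤ ∫⁻ x, ENNReal.ofReal (K * Real.exp (c₀ * n)) * G x := by
        rw [varModular_eq_lintegral_enorm hp]; exact lintegral_mono hpt
    _ = _ := by rw [lintegral_const_mul' _ _ ENNReal.ofReal_ne_top, hGint]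

end Young

section Approximation

variable {n : ℕ} {p : Euc n → ℝ} {c₀ C : ℝ}

theorem tendsto_varModular_sub_mollify_of_bdd (hpm : Measurable p) (hp : ∀ x, 2 ≤ p x)
    (hpC : ∀ x, p x ≤ C) {φ : ℕ → ContDiffBump (0 : Euc n)}
    (hφ : Tendsto (fun k => (φ k).rOut) atTop (𝓝 0))
    (hφ2 : ∀ k, (φ k).rOut ≤ 2 * (φ k).rIn) (hφ1 : ∀ k, (φ k).rOut ≤ 1)
    {F : Euc n → ℝ} (hF : LocallyIntegrable F) {R B : ℝ} (hFR : ∀ x, R < ‖x‖ → F x = 0)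
    (hB : 0 ≤ B) (hFB : ∀ x, |F x| ≤ B) :
    Tendsto (fun k => varModular n p (fun x => F x - mollify (φ k) F x)) atTop (𝓝 0) := by
  have hFm := hF.aestronglyMeasurable
  refine tendsto_varModular_of_dominated hpm hp
    (fun k => hFm.aemeasurable.sub (contDiff_mollify (φ k) hF).continuous.aemeasurable)
    ((Metric.closedBall 0 (R + 1)).indicator fun _ => ENNReal.ofReal ((2 * B + 1) ^ C)) ?_
    (fun k x => ?_) ?_
  · rw [lintegral_indicator_const measurableSet_closedBall]
    exact ENNReal.mul_ne_top ENNReal.ofReal_ne_top measure_closedBall_lt_top.ne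
  · rcases lt_or_ge (R + 1) ‖x‖ with hx | hx
    · have h0 : 0 < p x := by linarith [hp x]
      have h1 : F x = 0 := hFR x (by linarith)
      have h2 : mollify (φ k) F x = 0 := mollify_eq_zero _ hFR (by linarith [hφ1 k])
      simp [h1, h2, ENNReal.zero_rpow_of_pos h0]
    · rw [Set.indicator_of_mem (by simpa using hx)]
      have h1 : |F x - mollify (φ k) F x| ≤ 2 * B + 1 := by
        have := abs_sub (F x) (mollify (φ k) F x)
        linarith [hFB x, abs_mollify_le (φ k) hFm hB hFB x]
      simpa using enorm_mul_rpow_le hp hpC (by linarith : 1 ≤ 2 * B + 1) h1 (t := 1) x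
  · filter_upwards [ContDiffBump.ae_convolution_tendsto_right_of_locallyIntegrable (μ := volume)
      hφ (Eventually.of_forall hφ2) hF] with x hx
    simpa [mollify] using hx.const_sub (F x)

theorem tendsto_varModular_sub_mollify (hpm : Measurable p) (hp : ∀ x, 2 ≤ p x)
    (hpC : ∀ x, p x ≤ C) (hc : 0 < c₀)
    (hlog : ∀ x y : Euc n, dist x y < 1/2 → |p x - p y| ≤ c₀ / (- Real.log (dist x y)))
    {φ : ℕ → ContDiffBump (0 : Euc n)}
    (hφ : Tendsto (fun k => (φ k).rOut) atTop (𝓝 0))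
    (hφ2 : ∀ k, (φ k).rOut ≤ 2 * (φ k).rIn) (hφ1 : ∀ k, (φ k).rOut ≤ 1)
    {F : Euc n → ℝ} (hF : LocallyIntegrable F) {R : ℝ} (hFR : ∀ x, R < ‖x‖ → F x = 0)
    (hFp : MemVarLp n p F) :
    Tendsto (fun k => varModular n p (fun x => F x - mollify (φ k) F x)) atTop (𝓝 0) := by
  obtain ⟨K, hK⟩ := exists_varModular_mollify_le hpm hp hc hlog
  set T := ENNReal.ofReal (2 ^ C) with hT
  have hT' : T ≠ ⊤ := ENNReal.ofReal_ne_top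
  set a : ℕ → Euc n → ℝ := fun m x => if (m : ℝ) + 1 ≤ |F x| then 1 else 0 with ha
  have ham (m : ℕ) : AEMeasurable (a m) := by
    have h1 : Measurable fun t : ℝ => if (m : ℝ) + 1 ≤ |t| then (1 : ℝ) else 0 :=
      Measurable.ite (measurableSet_le measurable_const measurable_norm) measurable_const
        measurable_const
    exact h1.comp_aemeasurable hFp.1
  have ha1 (m : ℕ) (x : Euc n) : |a m x| ≤ 1 := by
    simp only [ha]; split_ifs <;> simp
  have ha1' (m : ℕ) (x : Euc n) : |1 - a m x| ≤ 1 := by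
    simp only [ha]; split_ifs <;> simp
  have halim (x : Euc n) : Tendsto (fun m => a m x) atTop (𝓝 0) := by
    obtain ⟨N, hN⟩ := exists_nat_gt |F x|
    refine tendsto_const_nhds.congr' ?_
    filter_upwards [eventually_ge_atTop N] with m hm
    have : (N : ℝ) ≤ m := by exact_mod_cast hm
    simp only [ha]
    rw [if_neg (by linarith)]
  have htail := tendsto_varModular_mul hpm hp hpC le_rfl ham hFp ha1 halim
  rw [ENNReal.tendsto_nhds_zero]
  intro η hη
  have hη2 : 0 < η / 2 := ENNReal.half_pos hη.ne'
  have hcoef : T * (T * (1 + ENNReal.ofReal K)) ≠ ⊤ :=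
    ENNReal.mul_ne_top hT' (ENNReal.mul_ne_top hT' (by simp))
  have htail' := ENNReal.Tendsto.const_mul htail (Or.inr hcoef)
  rw [mul_zero] at htail'
  obtain ⟨m, hm1, hm2⟩ := ((ENNReal.tendsto_nhds_zero.1 htail 1 one_pos).and
    (ENNReal.tendsto_nhds_zero.1 htail' _ hη2)).exists
  set F₁ : Euc n → ℝ := fun x => (1 - a m x) * F x with hF₁
  set F₂ : Euc n → ℝ := fun x => a m x * F x with hF₂
  have hF₁l : LocallyIntegrable F₁ :=
    locallyIntegrable_bdd_mul hF ((ham m).const_sub 1).aestronglyMeasurable (ha1' m)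
  have hF₂l : LocallyIntegrable F₂ :=
    locallyIntegrable_bdd_mul hF (ham m).aestronglyMeasurable (ha1 m)
  have hF₂1 (x : Euc n) : F₂ x = 0 ∨ 1 ≤ |F₂ x| := by
    simp only [hF₂, ha]
    split_ifs with h
    · right
      have : (0 : ℝ) ≤ m := m.cast_nonneg
      rw [one_mul]; linarith
    · simp
  have hF₁B (x : Euc n) : |F₁ x| ≤ (m : ℝ) + 1 := by
    simp only [hF₁, ha]
    split_ifs with h
    · simp; positivity
    · simpa using (not_le.1 h).le
  have hb := tendsto_varModular_sub_mollify_of_bdd hpm hp hpC hφ hφ2 hφ1 hF₁l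
    (R := R) (fun x hx => by simp [hF₁, hFR x hx]) (by positivity) hF₁B
  have hb' := ENNReal.Tendsto.const_mul hb (Or.inr hT')
  rw [mul_zero] at hb'
  have hlogφ : ∀ᶠ k in atTop, c₀ ≤ -Real.log (φ k).rOut := by
    have h1 : Tendsto (fun k => (φ k).rOut) atTop (𝓝[>] 0) :=
      tendsto_nhdsWithin_iff.2 ⟨hφ, Eventually.of_forall fun k => (φ k).rOut_pos⟩
    exact (tendsto_neg_atBot_atTop.comp
      (Real.tendsto_log_nhdsGT_zero.comp h1)).eventually_ge_atTop c₀
  filter_upwards [ENNReal.tendsto_nhds_zero.1 hb' _ hη2, hlogφ,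
    hφ.eventually_lt_const (by norm_num : (0 : ℝ) < 1 / 2)] with k hk1 hk2 hk3
  have hsplit (x : Euc n) : F x - mollify (φ k) F x =
      (F₁ x - mollify (φ k) F₁ x) + (F₂ x + (-1) * mollify (φ k) F₂ x) := by
    have h1 : F = fun x => F₁ x + F₂ x := by ext y; simp only [hF₁, hF₂]; ring
    have h2 := mollify_add (φ k) hF₁l hF₂l x
    rw [← h1] at h2
    rw [h2, congrFun h1 x]; ring
  have hneg : varModular n p (fun x => (-1) * mollify (φ k) F₂ x) =
      varModular n p (mollify (φ k) F₂) := by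
    simp [varModular]
  calc varModular n p (fun x => F x - mollify (φ k) F x)
      = varModular n p (fun x => (F₁ x - mollify (φ k) F₁ x) +
          (F₂ x + (-1) * mollify (φ k) F₂ x)) := by simp only [hsplit]
    _ ≤ T * (varModular n p (fun x => F₁ x - mollify (φ k) F₁ x) +
          varModular n p (fun x => F₂ x + (-1) * mollify (φ k) F₂ x)) :=
        varModular_add_le hpm hp hpC (hF₁l.aestronglyMeasurable.aemeasurable.sub
          (contDiff_mollify (φ k) hF₁l).continuous.aemeasurable)
    _ ≤ T * (varModular n p (fun x => F₁ x - mollify (φ k) F₁ x) +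
          T * (varModular n p F₂ + ENNReal.ofReal K * varModular n p F₂)) := by
        gcongr
        refine (varModular_add_le hpm hp hpC hF₂l.aestronglyMeasurable.aemeasurable).trans ?_
        rw [hneg]
        gcongr
        exact hK (φ k) (hφ2 k) hk3 hk2 F₂ hF₂l.aestronglyMeasurable.aemeasurable hF₂1 hm1
    _ = T * varModular n p (fun x => F₁ x - mollify (φ k) F₁ x) +
          T * (T * (1 + ENNReal.ofReal K)) * varModular n p F₂ := by ring
    _ ≤ η / 2 + η / 2 := add_le_add hk1 hm2
    _ = η := ENNReal.add_halves η

theorem exists_bump_seq (n : ℕ) : ∃ φ : ℕ → ContDiffBump (0 : Euc n),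
    Tendsto (fun k => (φ k).rOut) atTop (𝓝 0) ∧ (∀ k, (φ k).rOut ≤ 2 * (φ k).rIn) ∧
      ∀ k, (φ k).rOut ≤ 1 := by
  refine ⟨fun k => ⟨1 / ((k : ℝ) + 1) / 2, 1 / ((k : ℝ) + 1), by positivity,
    half_lt_self (by positivity)⟩, tendsto_one_div_add_atTop_nhds_zero_nat, fun k => ?_,
    fun k => ?_⟩
  · simp only; linarith
  · simp only
    rw [div_le_one (by positivity)]
    have : (0 : ℝ) ≤ k := k.cast_nonneg
    linarith

/-- Smooth cutoffs exhausting the space, with uniformly small gradients. -/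
theorem exists_cutoff_seq (n : ℕ) : ∃ χ : ℕ → Euc n → ℝ, ∃ B : ℝ, 1 ≤ B ∧
    (∀ k, ContDiff ℝ (⊤ : ℕ∞) (χ k)) ∧ (∀ k, HasCompactSupport (χ k)) ∧
    (∀ k x, |1 - χ k x| ≤ 1) ∧ (∀ k x, |χ k x| ≤ 1) ∧
    (∀ x, Tendsto (fun k => 1 - χ k x) atTop (𝓝 0)) ∧
    ∀ i : Fin n, (∀ k x, |fderiv ℝ (χ k) x (EuclideanSpace.single i 1)| ≤ B) ∧
      ∀ x, Tendsto (fun k => fderiv ℝ (χ k) x (EuclideanSpace.single i 1)) atTop (𝓝 0) := by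
  let ψ : ContDiffBump (0 : Euc n) := ⟨1, 2, one_pos, one_lt_two⟩
  have hψ : ContDiff ℝ (⊤ : ℕ∞) ψ := ψ.contDiff
  have hψc : HasCompactSupport ψ := ψ.hasCompactSupport
  obtain ⟨B₀, hB₀⟩ := (hψc.fderiv ℝ).exists_bound_of_continuous
    (hψ.continuous_fderiv (by simp))
  set s : ℕ → ℝ := fun k => 1 / ((k : ℝ) + 1) with hs
  have hs0 (k : ℕ) : 0 < s k := by simp only [hs]; positivity
  have hs1 (k : ℕ) : s k ≤ 1 := by
    simp only [hs]
    rw [div_le_one (by positivity)]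
    have : (0 : ℝ) ≤ k := k.cast_nonneg
    linarith
  have hslim : Tendsto s atTop (𝓝 0) := tendsto_one_div_add_atTop_nhds_zero_nat
  have hfd (k : ℕ) (x : Euc n) (i : Fin n) :
      |fderiv ℝ (fun x => ψ (s k • x)) x (EuclideanSpace.single i 1)| ≤ s k * max 1 B₀ := by
    have h1 : HasFDerivAt (fun x => ψ (s k • x))
        ((fderiv ℝ ψ (s k • x)).comp (s k • ContinuousLinearMap.id ℝ (Euc n))) x :=
      HasFDerivAt.comp (g := ψ) (f := fun x => s k • x) x
        (hψ.differentiable (by simp) (s k • x)).hasFDerivAt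
        ((hasFDerivAt_id x).const_smul (s k))
    rw [h1.fderiv]
    have h2 : |fderiv ℝ ψ (s k • x) (EuclideanSpace.single i 1)| ≤ max 1 B₀ := by
      refine ((fderiv ℝ ψ (s k • x)).le_opNorm _).trans ?_
      simpa using Or.inr (hB₀ (s k • x))
    simpa [abs_mul, abs_of_pos (hs0 k)] using mul_le_mul_of_nonneg_left h2 (hs0 k).le
  refine ⟨fun k x => ψ (s k • x), max 1 B₀, le_max_left _ _,
    fun k => hψ.comp (contDiff_const_smul _), fun k => ?_, fun k x => ?_, fun k x => ?_,
    fun x => ?_, fun i => ⟨fun k x => ?_, fun x => ?_⟩⟩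
  · exact hψc.comp_homeomorph (Homeomorph.smulOfNeZero (s k) (hs0 k).ne')
  · rw [abs_le]
    constructor <;> linarith [ψ.nonneg (x := s k • x), ψ.le_one (x := s k • x)]
  · rw [abs_le]
    constructor <;> linarith [ψ.nonneg (x := s k • x), ψ.le_one (x := s k • x)]
  · have h1 : Tendsto (fun k => s k * ‖x‖) atTop (𝓝 0) := by
      simpa using hslim.mul_const ‖x‖
    refine tendsto_const_nhds.congr' ?_
    filter_upwards [h1.eventually_le_const one_pos] with k hk
    rw [ψ.one_of_mem_closedBall, sub_self]
    simpa [norm_smul, abs_of_pos (hs0 k)] using hk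
  · exact (hfd k x i).trans (mul_le_of_le_one_left (by positivity) (hs1 k))
  · refine squeeze_zero_norm (fun k => hfd k x i) ?_
    simpa using hslim.mul_const (max 1 B₀)

theorem HasCompactSupport.exists_forall_lt_norm {E : Type*} [Zero E]
    {f : Euc n → E} (hf : HasCompactSupport f) :
    ∃ R : ℝ, ∀ x, R < ‖x‖ → f x = 0 := by
  obtain ⟨R, hR⟩ := hf.isCompact.isBounded.exists_norm_le
  refine ⟨R, fun x hx => ?_⟩
  by_contra h
  exact absurd (hR x (subset_tsupport f h)) (not_le.2 hx)

end Approximation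

/-- If `2 ≤ p⁻ ≤ p⁺ < ∞` and `p` is locally log-Hölder continuous, then
`C_0^∞(ℝⁿ)` is dense in `W^{1,p(·)}(ℝⁿ)`. -/
theorem density_of_log_holder
    (n : ℕ) (hn : 2 ≤ n) (p : Euc n → ℝ) (hp : Measurable p)
    (hp_lower : ∀ᵐ x ∂(volume : Measure (Euc n)), 2 ≤ p x)
    (hp_upper : ∃ C : ℝ, ∀ᵐ x ∂(volume : Measure (Euc n)), p x ≤ C)
    (hlog : ∃ c₀ : ℝ, 0 < c₀ ∧ ∀ x y : Euc n, dist x y < 1/2 →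
      |p x - p y| ≤ c₀ / (- Real.log (dist x y))) :
    DenseSmooth n p := by
  obtain ⟨C, hC⟩ := hp_upper
  obtain ⟨c₀, hc, hlog⟩ := hlog
  have hcont := continuous_of_log_holder hlog
  have hp2 : ∀ x, 2 ≤ p x := forall_le_of_ae_le continuous_const hcont hp_lower
  have hpC : ∀ x, p x ≤ C := forall_le_of_ae_le hcont continuous_const hC
  intro f Df hf hDf ε hε
  obtain ⟨χ, B, hB, hχ, hχc, hχ1, hχ1', hχlim, hχd⟩ := exists_cutoff_seq n
  obtain ⟨φ, hφ, hφ2, hφ1⟩ := exists_bump_seq n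
  set e : Fin n → Euc n := fun i => EuclideanSpace.single i 1 with he
  have hdc (k : ℕ) (i : Fin n) : Continuous fun x => fderiv ℝ (χ k) x (e i) :=
    ((hχ k).continuous_fderiv (by simp)).clm_apply continuous_const
  set F : ℕ → Euc n → ℝ := fun k x => χ k x * f x with hF
  set DF : ℕ → Fin n → Euc n → ℝ :=
    fun k i x => χ k x * Df i x + fderiv ℝ (χ k) x (e i) * f x with hDF
  have hFw (k : ℕ) (i : Fin n) : IsWeakDeriv n i (F k) (DF k i) :=
    (hDf i).1.smooth_mul (hχ k) (hχc k)
  have hFp (k : ℕ) : MemVarLp n p (F k) :=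
    hf.bdd_mul hp2 hpC (hχ k).continuous.aemeasurable (hχ1' k)
  have hDFp (k : ℕ) (i : Fin n) : MemVarLp n p (DF k i) :=
    ((hDf i).2.bdd_mul hp2 hpC (hχ k).continuous.aemeasurable (hχ1' k)).add hp hp2 hpC
      (hf.bdd_mul hp2 hpC (hdc k i).aemeasurable ((hχd i).1 k))
  have hFlim : Tendsto (fun k => varModular n p fun x => f x - F k x) atTop (𝓝 0) := by
    have := tendsto_varModular_mul hp hp2 hpC le_rfl (a := fun k x => 1 - χ k x)
      (fun k => (continuous_const.sub (hχ k).continuous).aemeasurable) hf hχ1 hχlim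
    simpa only [hF, sub_mul, one_mul] using this
  have hDFlim (i : Fin n) :
      Tendsto (fun k => varModular n p fun x => Df i x - DF k i x) atTop (𝓝 0) := by
    have h1 := tendsto_varModular_mul hp hp2 hpC le_rfl (a := fun k x => 1 - χ k x)
      (fun k => (continuous_const.sub (hχ k).continuous).aemeasurable) (hDf i).2 hχ1 hχlim
    have h2 := tendsto_varModular_mul hp hp2 hpC hB (fun k => (hdc k i).neg.aemeasurable) hf
      (fun k x => (abs_neg _).trans_le ((hχd i).1 k x))
      (fun x => by simpa using ((hχd i).2 x).neg)
    have h3 := tendsto_varModular_add hp hp2 hpC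
      (f := fun k x => (1 - χ k x) * Df i x) (fun k =>
      (continuous_const.sub (hχ k).continuous).aemeasurable.mul (hDf i).2.1) h1 h2
    refine h3.congr fun k => ?_
    congr 1; ext x; simp only [hDF, Pi.neg_apply]; ring
  set c : ℝ := min 1 (ε / (n + 2)) with hcdef
  have hc0 : 0 < c := by positivity
  set T := ENNReal.ofReal (2 ^ C) with hT
  have hT' : T ≠ ⊤ := ENNReal.ofReal_ne_top
  have hη : 0 < ENNReal.ofReal (c ^ C) / 2 :=
    ENNReal.half_pos (ENNReal.ofReal_pos.2 (by positivity)).ne'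
  have hsmall {u : ℕ → ℝ≥0∞} (hu : Tendsto u atTop (𝓝 0)) :
      ∀ᶠ k in atTop, T * u k ≤ ENNReal.ofReal (c ^ C) / 2 := by
    have := ENNReal.Tendsto.const_mul hu (Or.inr hT')
    rw [mul_zero] at this
    exact ENNReal.tendsto_nhds_zero.1 this _ hη
  obtain ⟨k, hk1, hk2⟩ := ((hsmall hFlim).and
    (eventually_all.2 fun i => hsmall (hDFlim i))).exists
  obtain ⟨R, hR⟩ := (hχc k).exists_forall_lt_norm
  obtain ⟨R', hR'⟩ := ((hχc k).fderiv ℝ).exists_forall_lt_norm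
  have hFl : LocallyIntegrable (F k) := (hFw k ⟨0, by omega⟩).1
  have hFR (x : Euc n) (hx : R < ‖x‖) : F k x = 0 := by simp [hF, hR x hx]
  have hDFR (i : Fin n) (x : Euc n) (hx : max R R' < ‖x‖) : DF k i x = 0 := by
    simp [hDF, hR x ((le_max_left _ _).trans_lt hx), hR' x ((le_max_right _ _).trans_lt hx)]
  have hmol := tendsto_varModular_sub_mollify hp hp2 hpC hc hlog hφ hφ2 hφ1 hFl hFR (hFp k)
  have hmolD (i : Fin n) := tendsto_varModular_sub_mollify hp hp2 hpC hc hlog hφ hφ2 hφ1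
    (hFw k i).2.1 (hDFR i) (hDFp k i)
  obtain ⟨j, hj1, hj2⟩ := ((hsmall hmol).and
    (eventually_all.2 fun i => hsmall (hmolD i))).exists
  have hnorm {u v w : Euc n → ℝ} (hu : AEMeasurable u) (hv : AEMeasurable v)
      (h1 : T * varModular n p (fun x => u x - v x) ≤ ENNReal.ofReal (c ^ C) / 2)
      (h2 : T * varModular n p (fun x => v x - w x) ≤ ENNReal.ofReal (c ^ C) / 2) :
      varNorm n p (fun x => u x - w x) ≤ c := by
    refine varNorm_le_of_varModular_le hp2 hpC hc0 (min_le_left _ _) ?_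
    have h3 := varModular_add_le hp hp2 hpC (g := fun x => v x - w x) (hu.sub hv)
    simp only [Pi.sub_apply, sub_add_sub_cancel] at h3
    refine h3.trans ?_
    rw [mul_add, ← ENNReal.add_halves (ENNReal.ofReal (c ^ C))]
    exact add_le_add h1 h2
  refine ⟨mollify (φ j) (F k), contDiff_mollify _ hFl, ?_, ?_⟩
  · refine HasCompactSupport.of_support_subset_isCompact
      (isCompact_closedBall (0 : Euc n) (R + (φ j).rOut)) fun x hx => ?_
    by_contra h
    exact hx (mollify_eq_zero _ hFR (by simpa using h))
  · have hsum : ∑ i : Fin n, varNorm n p (fun x => Df i x -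
        fderiv ℝ (mollify (φ j) (F k)) x (EuclideanSpace.single i 1)) ≤ ∑ _i : Fin n, c := by
      refine Finset.sum_le_sum fun i _ => ?_
      simp only [fderiv_mollify (φ j) (hFw k i)]
      exact hnorm (hDf i).2.1 (hDFp k i).1 (hk2 i) (hj2 i)
    rw [Finset.sum_const, Finset.card_univ, Fintype.card_fin, nsmul_eq_mul] at hsum
    have h1 := hnorm hf.1 (hFp k).1 hk1 hj1
    have h2 : c * (n + 2) ≤ ε := (le_div_iff₀ (by positivity)).1 (min_le_right _ _)
    linarith
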